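/- There exists λ0 > 0 such that for every λ ≥ λ0 and every x ∈ ℝ^N one has 𝒱_λ(x) > 0. -/

import Mathlib

open Real

/-- The potential `𝒱_λ` associated with the operator `A`. -/
noncomputable def pot (N : ℕ) (α β b c lam : ℝ) (x : EuclideanSpace ℝ (Fin N)) : ℝ :=
  (b ^ 2 / 4 - b * α / 2) * ‖x‖ ^ (2 * α - 2) / (1 + ‖x‖ ^ α) ^ 2
    + (b / 2) * ((N : ℝ) + α - 2) * ‖x‖ ^ (α - 2) / (1 + ‖x‖ ^ α)
    + (c * ‖x‖ ^ β + lam) / (1 + ‖x‖ ^ α)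

/-- There exists `λ0 > 0` such that for every `λ ≥ λ0` and every
`x ∈ ℝ^N` one has `𝒱_λ(x) > 0`. -/
theorem stmt13 (N : ℕ) (hN : 2 < N) (α β b c : ℝ) (hα : 2 < α) (hβ : α - 2 < β)
    (hc : 0 < c) :
    ∃ lam0 : ℝ, 0 < lam0 ∧ ∀ lam : ℝ, lam0 ≤ lam →
      ∀ x : EuclideanSpace ℝ (Fin N), 0 < pot N α β b c lam x := by
  set A := b ^ 2 / 4 - b * α / 2 with hA
  set B := (b / 2) * ((N : ℝ) + α - 2) with hB
  set K := |A| + |B| with hK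
  have hK0 : 0 ≤ K := by positivity
  set R := (K / c + 1) ^ (1 / (β - (α - 2))) with hR
  have hbase : 0 < K / c + 1 := by positivity
  have hR0 : 0 < R := Real.rpow_pos_of_pos hbase _
  have hd : 0 < β - (α - 2) := by linarith
  have hRd : R ^ (β - (α - 2)) = K / c + 1 := by
    rw [hR, ← Real.rpow_mul hbase.le, one_div, inv_mul_cancel₀ hd.ne', Real.rpow_one]
  refine ⟨K * R ^ (α - 2) + 1, by positivity, fun lam hlam x => ?_⟩
  have key : ∀ r : ℝ, 0 ≤ r → K * r ^ (α - 2) < c * r ^ β + lam := by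
    intro r hr
    rcases le_total r R with h | h
    · have h1 : r ^ (α - 2) ≤ R ^ (α - 2) := Real.rpow_le_rpow hr h (by linarith)
      have h2 := mul_le_mul_of_nonneg_left h1 hK0
      have h3 : 0 ≤ c * r ^ β := by positivity
      linarith
    · have hr0 : 0 < r := hR0.trans_le h
      have h1 : R ^ (β - (α - 2)) ≤ r ^ (β - (α - 2)) := Real.rpow_le_rpow hR0.le h hd.le
      rw [hRd] at h1
      have h2 : r ^ β = r ^ (β - (α - 2)) * r ^ (α - 2) := by
        rw [← Real.rpow_add hr0]; congr 1; ring
      have h3 : K ≤ c * r ^ (β - (α - 2)) := by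
        have h4 := mul_le_mul_of_nonneg_left h1 hc.le
        have h5 : c * (K / c + 1) = K + c := by field_simp
        linarith
      have h4 := mul_le_mul_of_nonneg_right h3 (Real.rpow_nonneg hr (α - 2))
      have h5 : 0 ≤ K * R ^ (α - 2) := by positivity
      rw [h2]
      linarith
  unfold pot
  rw [← hA, ← hB]
  have hr : 0 ≤ ‖x‖ := norm_nonneg x
  generalize ‖x‖ = r at hr
  have k := key r hr
  have hs : r ^ (2 * α - 2) = r ^ (α - 2) * r ^ α := by
    rw [← Real.rpow_add_of_nonneg hr (by linarith) (by linarith)]; congr 1; ring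
  rw [hs]
  have hs0 : 0 ≤ r ^ (α - 2) := Real.rpow_nonneg hr _
  have ht0 : 0 ≤ r ^ α := Real.rpow_nonneg hr _
  generalize r ^ (α - 2) = s at *
  generalize r ^ α = t at *
  generalize c * r ^ β + lam = M at *
  have ht1 : 0 < 1 + t := by linarith
  have e : A * (s * t) / (1 + t) ^ 2 + B * s / (1 + t) + M / (1 + t)
      = (A * s * (t / (1 + t)) + B * s + M) / (1 + t) := by
    field_simp
  rw [e]
  apply div_pos _ ht1
  have hu0 : 0 ≤ t / (1 + t) := by positivity
  have hu1 : t / (1 + t) ≤ 1 := by rw [div_le_one ht1]; linarith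
  generalize t / (1 + t) = u at *
  have a1 : -(|A| * s) ≤ A * s * u := by
    have h1 : |A * s * u| ≤ |A| * s := by
      rw [abs_mul, abs_mul, abs_of_nonneg hs0, abs_of_nonneg hu0]
      exact mul_le_of_le_one_right (by positivity) hu1
    exact (abs_le.mp h1).1
  have a2 : -(|B| * s) ≤ B * s := by
    have := mul_le_mul_of_nonneg_right (neg_abs_le B) hs0
    linarith
  have a3 : K * s = |A| * s + |B| * s := by rw [hK]; ring
  linarith
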